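/- Krivine–Stengle Positivstellensatz: Let N ∈ ℕ, and let (f_i)_{i ∈ I}, (g_j)_{j ∈ J}, (h_k)_{k ∈ K} be finite families in R = ℝ[y₁,…,y_N]. The semialgebraic set {a ∈ ℝᴺ : f_i(a) ≥ 0 for all i ∈ I, g_j(a) ≠ 0 for all j ∈ J, h_k(a) = 0 for all k ∈ K} is empty if and only if there exist F ∈ Cone({f_i : i ∈ I}), G ∈ Monoid({g_j : j ∈ J}), and H ∈ Ideal({h_k : k ∈ K}) such that F + G² + H = 0. -/

import Mathlib

open MvPolynomial

/-- A polynomial is a sum of squares if it is a finite sum of squares of polynomials. -/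
def IsSOS {σ : Type*} (s : MvPolynomial σ ℝ) : Prop :=
  ∃ (k : ℕ) (p : Fin k → MvPolynomial σ ℝ), s = ∑ i, p i ^ 2

open scoped Polynomial

/-- The intermediate value property for polynomials over an ordered field. -/
def HasPolynomialIVP (L : Type*) [Field L] [LinearOrder L] : Prop :=
  ∀ (p : L[X]) ⦃a b : L⦄, a < b → p.eval a < 0 → 0 < p.eval b → ∃ c ∈ Set.Ioo a b, p.eval c = 0

namespace HasPolynomialIVP

open Polynomial (derivative)

variable {L : Type*} [Field L] [LinearOrder L] [IsStrictOrderedRing L]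

theorem exists_root_of_mul_neg (hL : HasPolynomialIVP L) (p : L[X]) {a b : L} (hab : a < b)
    (hp : p.eval a * p.eval b < 0) : ∃ c ∈ Set.Ioo a b, p.eval c = 0 := by
  rcases mul_neg_iff.1 hp with ⟨h1, h2⟩ | ⟨h1, h2⟩
  · obtain ⟨c, hc, hc0⟩ := hL (-p) hab (by simpa using h1) (by simpa using h2)
    exact ⟨c, hc, by simpa using hc0⟩
  · exact hL p hab h1 h2

theorem mul_pos_of_forall_ne_zero (hL : HasPolynomialIVP L) (p : L[X]) {a b : L} (hab : a ≤ b)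
    (hp : ∀ z ∈ Set.Icc a b, p.eval z ≠ 0) : 0 < p.eval a * p.eval b := by
  have ha := hp a ⟨le_rfl, hab⟩
  have hb := hp b ⟨hab, le_rfl⟩
  rcases hab.eq_or_lt with rfl | hab
  · exact mul_self_pos.2 ha
  · by_contra! h
    obtain ⟨c, hc, hc0⟩ := hL.exists_root_of_mul_neg p hab (h.lt_of_ne (mul_ne_zero ha hb))
    exact hp c ⟨hc.1.le, hc.2.le⟩ hc0

theorem sign_eq_of_forall_ne_zero (hL : HasPolynomialIVP L) (p : L[X]) {a b : L}
    (hp : ∀ z ∈ Set.uIcc a b, p.eval z ≠ 0) :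
    SignType.sign (p.eval a) = SignType.sign (p.eval b) := by
  have key : 0 < p.eval a * p.eval b := by
    rcases le_total a b with hab | hab
    · exact hL.mul_pos_of_forall_ne_zero p hab (by rwa [Set.uIcc_of_le hab] at hp)
    · rw [mul_comm]
      exact hL.mul_pos_of_forall_ne_zero p hab (by rwa [Set.uIcc_of_ge hab] at hp)
  rcases mul_pos_iff.1 key with ⟨h1, h2⟩ | ⟨h1, h2⟩
  · rw [sign_pos h1, sign_pos h2]
  · rw [sign_neg h1, sign_neg h2]

/-- Rolle's theorem between two consecutive roots. -/
theorem exists_derivative_eq_zero_of_consecutive (hL : HasPolynomialIVP L) {q : L[X]} (hq : q ≠ 0)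
    {a b : L} (hab : a < b) (ha : q.eval a = 0) (hb : q.eval b = 0)
    (hne : ∀ z ∈ Set.Ioo a b, q.eval z ≠ 0) : ∃ c ∈ Set.Ioo a b, (derivative q).eval c = 0 := by
  obtain ⟨r, hr, hra⟩ := q.exists_eq_pow_rootMultiplicity_mul_and_not_dvd hq a
  have hr0 : r ≠ 0 := by rintro rfl; simp at hra
  obtain ⟨s, hs, hsb⟩ := r.exists_eq_pow_rootMultiplicity_mul_and_not_dvd hr0 b
  rw [Polynomial.dvd_iff_isRoot, Polynomial.IsRoot] at hra hsb
  have hm : q.rootMultiplicity a ≠ 0 := by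
    rw [← Nat.pos_iff_ne_zero, Polynomial.rootMultiplicity_pos hq]; exact ha
  have hn : r.rootMultiplicity b ≠ 0 := by
    rw [← Nat.pos_iff_ne_zero, Polynomial.rootMultiplicity_pos hr0]
    have h := hb
    rw [hr, Polynomial.eval_mul, mul_eq_zero] at h
    refine h.resolve_left ?_
    simp [sub_eq_zero, hab.ne']
  obtain ⟨m, hm⟩ := Nat.exists_eq_succ_of_ne_zero hm
  obtain ⟨n, hn⟩ := Nat.exists_eq_succ_of_ne_zero hn
  rw [hm] at hr
  rw [hn] at hs
  have hsa : s.eval a ≠ 0 := by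
    intro h; apply hra; rw [hs, Polynomial.eval_mul, h, mul_zero]
  have hs_ne : ∀ z ∈ Set.Icc a b, s.eval z ≠ 0 := by
    rintro z ⟨hz1, hz2⟩ h
    rcases hz1.eq_or_lt with rfl | hz1
    · exact hsa h
    rcases hz2.eq_or_lt with rfl | hz2
    · exact hsb h
    exact hne z ⟨hz1, hz2⟩ (by rw [hr, hs]; simp [h])
  have hpos := hL.mul_pos_of_forall_ne_zero s hab.le hs_ne
  set w : L[X] := Polynomial.C ((m : L) + 1) * (Polynomial.X - Polynomial.C b) * s +
      Polynomial.C ((n : L) + 1) * (Polynomial.X - Polynomial.C a) * s +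
    (Polynomial.X - Polynomial.C a) * (Polynomial.X - Polynomial.C b) * derivative s with hw
  have hder : derivative q =
      (Polynomial.X - Polynomial.C a) ^ m * (Polynomial.X - Polynomial.C b) ^ n * w := by
    rw [hr, hs, hw]
    simp only [Polynomial.derivative_mul, Polynomial.derivative_X_sub_C_pow, Nat.succ_eq_add_one,
      Nat.add_sub_cancel, map_add, map_natCast, map_one, Nat.cast_add,
      Nat.cast_one]
    ring
  have hwab : w.eval a * w.eval b < 0 := by
    have h1 : w.eval a * w.eval b =
        -(((m : L) + 1) * ((n : L) + 1) * (b - a) ^ 2 * (s.eval a * s.eval b)) := by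
      simp [hw]; ring
    rw [h1, neg_lt_zero]
    have := sub_pos.2 hab
    positivity
  obtain ⟨c, hc, hc0⟩ := hL.exists_root_of_mul_neg w hab hwab
  exact ⟨c, hc, by rw [hder, Polynomial.eval_mul, hc0, mul_zero]⟩

theorem exists_derivative_eq_zero (hL : HasPolynomialIVP L) (p : L[X]) {a b : L} (hab : a < b)
    (h : p.eval a = p.eval b) : ∃ c ∈ Set.Ioo a b, (derivative p).eval c = 0 := by
  set q := p - Polynomial.C (p.eval a) with hq
  have hqd : derivative p = derivative q := by simp [hq]
  rw [hqd]
  by_cases hq0 : q = 0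
  · obtain ⟨c, hc⟩ := exists_between hab
    exact ⟨c, hc, by simp [hq0]⟩
  have hqa : q.eval a = 0 := by simp [hq]
  have hqb : q.eval b = 0 := by simp [hq, h]
  have hmem : b ∈ q.roots.toFinset.filter (a < ·) := by
    simp only [Finset.mem_filter, Multiset.mem_toFinset, Polynomial.mem_roots hq0,
      Polynomial.IsRoot]
    exact ⟨hqb, hab⟩
  obtain ⟨b', hb', hmin⟩ := Finset.exists_min_image _ id ⟨b, hmem⟩
  simp only [Finset.mem_filter, Multiset.mem_toFinset, Polynomial.mem_roots hq0,
    Polynomial.IsRoot, id] at hb' hmin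
  obtain ⟨c, hc, hc0⟩ := hL.exists_derivative_eq_zero_of_consecutive hq0 hb'.2 hqa hb'.1
    fun z hz hz0 => (hmin z ⟨hz0, hz.1⟩).not_gt hz.2
  exact ⟨c, ⟨hc.1, hc.2.trans_le (hmin b ⟨hqb, hab⟩)⟩, hc0⟩

theorem exists_eval_sub_eq (hL : HasPolynomialIVP L) (p : L[X]) {a b : L} (hab : a < b) :
    ∃ c ∈ Set.Ioo a b, p.eval b - p.eval a = (derivative p).eval c * (b - a) := by
  have hne : b - a ≠ 0 := (sub_pos.2 hab).ne'
  obtain ⟨c, hc, hc0⟩ := hL.exists_derivative_eq_zero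
    (p - Polynomial.C ((p.eval b - p.eval a) / (b - a)) * Polynomial.X) hab (by
      simp only [Polynomial.eval_sub, Polynomial.eval_mul, Polynomial.eval_C, Polynomial.eval_X]
      field_simp; ring)
  refine ⟨c, hc, ?_⟩
  simp only [Polynomial.derivative_sub, Polynomial.derivative_mul, Polynomial.derivative_C,
    Polynomial.derivative_X, zero_mul, mul_one, zero_add, Polynomial.eval_sub,
    Polynomial.eval_C, sub_eq_zero] at hc0
  rw [hc0]; field_simp

theorem strictMonoOn (hL : HasPolynomialIVP L) (p : L[X]) {a b m : L} (hm : m ∈ Set.Ioo a b)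
    (hm0 : 0 < (derivative p).eval m) (hp : ∀ z ∈ Set.Ioo a b, (derivative p).eval z ≠ 0) :
    StrictMonoOn (fun x => p.eval x) (Set.Icc a b) := by
  intro x hx y hy hxy
  obtain ⟨c, hc, h⟩ := hL.exists_eval_sub_eq p hxy
  have hc' : c ∈ Set.Ioo a b := ⟨hx.1.trans_lt hc.1, hc.2.trans_le hy.2⟩
  have hsign := hL.sign_eq_of_forall_ne_zero (derivative p) (a := m) (b := c)
    fun z hz => hp z (Set.ordConnected_Ioo.uIcc_subset hm hc' hz)
  rw [sign_pos hm0, eq_comm, sign_eq_one_iff] at hsign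
  exact sub_pos.1 (h ▸ mul_pos hsign (sub_pos.2 hxy))

end HasPolynomialIVP

section OrderedFieldHom

open Polynomial (derivative eval₂)

variable {k L : Type*} [Field k] [LinearOrder k] [IsStrictOrderedRing k]
  [Field L] [LinearOrder L] [IsStrictOrderedRing L]

omit [IsStrictOrderedRing k] [IsStrictOrderedRing L] in
theorem StrictMono.sign_map_ringHom {φ : k →+* L} (hφ : StrictMono φ) (a : k) :
    SignType.sign (φ a) = SignType.sign a := by
  rcases lt_trichotomy a 0 with h | rfl | h
  · rw [sign_neg h, sign_neg (by simpa using hφ h)]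
  · simp
  · rw [sign_pos h, sign_pos (by simpa using hφ h)]

theorem StrictMono.abs_map_ringHom {φ : k →+* L} (hφ : StrictMono φ) (a : k) :
    |φ a| = φ |a| := by
  rcases le_total 0 a with h | h
  · rw [abs_of_nonneg h, abs_of_nonneg (by simpa using hφ.monotone h)]
  · rw [abs_of_nonpos h, abs_of_nonpos (by simpa using hφ.monotone h), map_neg]

/-- A root of a polynomial is bounded by an element of the base field. -/
theorem Polynomial.exists_abs_lt_map_of_eval₂_eq_zero {φ : k →+* L} (hφ : StrictMono φ) {p : k[X]}
    (hp : p ≠ 0) {x : L} (hx : p.eval₂ φ x = 0) : ∃ v, |x| < φ v := by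
  set M := ∑ i ∈ Finset.range p.natDegree, |p.coeff i| with hM
  have hM0 : 0 ≤ M := Finset.sum_nonneg fun _ _ => abs_nonneg _
  have hlc : 0 < |p.leadingCoeff| := abs_pos.2 (Polynomial.leadingCoeff_ne_zero.2 hp)
  refine ⟨1 + (M / |p.leadingCoeff| + 1), ?_⟩
  have hdiv : 0 ≤ φ (M / |p.leadingCoeff|) := by
    simpa using hφ.monotone (div_nonneg hM0 hlc.le)
  rw [map_add, map_add, map_one]
  rcases lt_or_ge |x| 1 with h1 | h1
  · linarith
  rw [Polynomial.eval₂_eq_sum_range, Finset.sum_range_succ] at hx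
  rcases hn : p.natDegree with _ | n
  · rw [hn] at hx
    have : p.leadingCoeff = 0 := by
      rw [Polynomial.leadingCoeff, hn]
      exact φ.injective (by simpa using hx)
    simp [this] at hlc
  have h2 : φ |p.leadingCoeff| * |x| ^ (n + 1) ≤ φ M * |x| ^ n := by
    calc φ |p.leadingCoeff| * |x| ^ (n + 1)
        = |∑ i ∈ Finset.range p.natDegree, φ (p.coeff i) * x ^ i| := by
          rw [eq_neg_of_add_eq_zero_left hx, hn, abs_neg, abs_mul, abs_pow,
            hφ.abs_map_ringHom, Polynomial.leadingCoeff, hn]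
      _ ≤ ∑ i ∈ Finset.range p.natDegree, |φ (p.coeff i) * x ^ i| :=
          Finset.abs_sum_le_sum_abs _ _
      _ ≤ ∑ i ∈ Finset.range p.natDegree, φ |p.coeff i| * |x| ^ n := by
          refine Finset.sum_le_sum fun i hi => ?_
          rw [abs_mul, abs_pow, hφ.abs_map_ringHom]
          have hi' : i ≤ n := by have := Finset.mem_range.1 hi; omega
          refine mul_le_mul_of_nonneg_left (pow_le_pow_right₀ h1 hi') ?_
          simpa using hφ.monotone (abs_nonneg (p.coeff i))
      _ = φ M * |x| ^ n := by rw [hM, map_sum, Finset.sum_mul]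
  have hxn : 0 < |x| ^ n := by positivity
  have h3 : φ |p.leadingCoeff| * |x| ≤ φ M := by
    refine le_of_mul_le_mul_right ?_ hxn
    calc _ = φ |p.leadingCoeff| * |x| ^ (n + 1) := by ring
      _ ≤ _ := h2
  have hlc' : 0 < φ |p.leadingCoeff| := by simpa using hφ hlc
  have h4 : |x| ≤ φ (M / |p.leadingCoeff|) := by
    rw [map_div₀, le_div_iff₀ hlc']; linarith
  linarith

omit [IsStrictOrderedRing L] in
theorem exists_same_side {φ : k →+* L} (hφ : StrictMono φ) (R : Finset k) (x : L)
    (hx : ∀ r ∈ R, φ r ≠ x) : ∃ m, ∀ r ∈ R, r ≠ m ∧ (r < m ↔ φ r < x) := by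
  obtain ⟨m, h1, h2⟩ := Order.exists_between_finsets (R.filter (φ · < x)) (R.filter (x < φ ·))
    fun r hr s hs => hφ.lt_iff_lt.1 ((Finset.mem_filter.1 hr).2.trans (Finset.mem_filter.1 hs).2)
  refine ⟨m, fun r hr => ?_⟩
  rcases (hx r hr).lt_or_gt with h | h
  · have := h1 r (Finset.mem_filter.2 ⟨hr, h⟩)
    exact ⟨this.ne, by simp [this, h]⟩
  · have := h2 r (Finset.mem_filter.2 ⟨hr, h⟩)
    exact ⟨this.ne', iff_of_false this.not_gt h.not_gt⟩

omit [IsStrictOrderedRing k] [IsStrictOrderedRing L] in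
theorem exists_isolating {φ : k →+* L} (hφ : StrictMono φ) (R : Finset k) (x : L)
    (hx : ∀ r ∈ R, φ r ≠ x) {u v : k} (hu : φ u < x) (hv : x < φ v) :
    ∃ a b, φ a < x ∧ x < φ b ∧ ∀ r ∈ R, r ∉ Set.Ioo a b := by
  induction R using Finset.induction_on with
  | empty => exact ⟨u, v, hu, hv, by simp⟩
  | insert r R _ ih =>
    obtain ⟨a, b, ha, hb, h⟩ := ih fun s hs => hx s (Finset.mem_insert_of_mem hs)
    rcases (hx r (Finset.mem_insert_self _ _)).lt_or_gt with hr | hr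
    · refine ⟨max a r, b, ?_, hb, ?_⟩
      · rw [hφ.monotone.map_max]; exact max_lt ha hr
      · intro s hs hsab
        rcases Finset.mem_insert.1 hs with rfl | hs
        · exact (le_max_right a s).not_gt hsab.1
        · exact h s hs ⟨(le_max_left a r).trans_lt hsab.1, hsab.2⟩
    · refine ⟨a, min b r, ha, ?_, ?_⟩
      · rw [hφ.monotone.map_min]; exact lt_min hb hr
      · intro s hs hsab
        rcases Finset.mem_insert.1 hs with rfl | hs
        · exact (min_le_right b s).not_gt hsab.2
        · exact h s hs ⟨hsab.1, hsab.2.trans_le (min_le_left b r)⟩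

omit [LinearOrder L] [IsStrictOrderedRing L] in
theorem Polynomial.derivative_ne_zero_of_eval₂_eq_zero {φ : k →+* L} {p : k[X]} (hp : p ≠ 0)
    {x : L} (hx : p.eval₂ φ x = 0) : derivative p ≠ 0 := by
  rw [Ne, Polynomial.derivative_eq_zero, Polynomial.natDegree_eq_zero]
  rintro ⟨c, rfl⟩
  simp_all

/-- All roots in `L` of the polynomial `p` over `k` come from `k`. -/
def Polynomial.RootsInRange (φ : k →+* L) (p : k[X]) : Prop :=
  ∀ z, p.eval₂ φ z = 0 → ∃ r, φ r = z

omit [LinearOrder k] [IsStrictOrderedRing k] [LinearOrder L] [IsStrictOrderedRing L] in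
theorem Polynomial.RootsInRange.exists_root {φ : k →+* L} {p : k[X]} (hp : p.RootsInRange φ)
    {z : L} (hz : p.eval₂ φ z = 0) : ∃ r, φ r = z ∧ p.eval r = 0 := by
  obtain ⟨r, rfl⟩ := hp z hz
  rw [Polynomial.eval₂_at_apply, map_eq_zero] at hz
  exact ⟨r, rfl, hz⟩

omit [IsStrictOrderedRing k] in
theorem HasPolynomialIVP.sign_eval₂_eq (hL : HasPolynomialIVP L) {φ : k →+* L} (hφ : StrictMono φ)
    {p : k[X]} (hp : p.RootsInRange φ) {x : L} {m : k}
    (hm : ∀ r, p.eval r = 0 → φ r ≠ x ∧ r ≠ m ∧ (r < m ↔ φ r < x)) :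
    SignType.sign (p.eval₂ φ x) = SignType.sign (p.eval m) := by
  rw [← hφ.sign_map_ringHom, ← Polynomial.eval₂_at_apply, Polynomial.eval₂_eq_eval_map,
    Polynomial.eval₂_eq_eval_map]
  refine hL.sign_eq_of_forall_ne_zero _ fun z hz hz0 => ?_
  rw [← Polynomial.eval₂_eq_eval_map] at hz0
  obtain ⟨r, rfl, hr⟩ := hp.exists_root hz0
  obtain ⟨h1, h2, h3⟩ := hm r hr
  rw [Set.mem_uIcc, hφ.le_iff_le, hφ.le_iff_le] at hz
  rcases hz with ⟨ha, hb⟩ | ⟨ha, hb⟩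
  · exact ha.not_gt (h3.1 (lt_of_le_of_ne hb h2))
  · exact ha.not_gt (h3.2 (lt_of_le_of_ne hb h1))

end OrderedFieldHom

section TwoExtensions

open Polynomial (derivative eval₂ RootsInRange)

variable {k L₁ L₂ : Type*} [Field k] [LinearOrder k] [IsStrictOrderedRing k]
  [Field L₁] [LinearOrder L₁] [IsStrictOrderedRing L₁]
  [Field L₂] [LinearOrder L₂] [IsStrictOrderedRing L₂]

omit [IsStrictOrderedRing k] in
theorem HasPolynomialIVP.strictMonoOn_eval₂ (h₁ : HasPolynomialIVP L₁)
    {φ₁ : k →+* L₁} (hφ₁ : StrictMono φ₁) {p : k[X]} {a b m : k}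
    (hm : m ∈ Set.Ioo a b) (hm0 : 0 < (derivative p).eval m)
    (hR₁ : (derivative p).RootsInRange φ₁) (hR : ∀ r ∈ Set.Ioo a b, (derivative p).eval r ≠ 0) :
    StrictMonoOn (fun x => p.eval₂ φ₁ x) (Set.Icc (φ₁ a) (φ₁ b)) := by
  simp only [Polynomial.eval₂_eq_eval_map]
  refine h₁.strictMonoOn (p.map φ₁) (m := φ₁ m) ⟨hφ₁ hm.1, hφ₁ hm.2⟩ ?_ ?_
  · rw [Polynomial.derivative_map, ← Polynomial.eval₂_eq_eval_map, Polynomial.eval₂_at_apply]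
    simpa using hφ₁ hm0
  · intro z hz hz0
    rw [Polynomial.derivative_map, ← Polynomial.eval₂_eq_eval_map] at hz0
    obtain ⟨r, rfl, hr⟩ := hR₁.exists_root hz0
    exact hR r ⟨hφ₁.lt_iff_lt.1 hz.1, hφ₁.lt_iff_lt.1 hz.2⟩ hr

omit [IsStrictOrderedRing k] in
theorem exists_sameCut_of_derivative_pos (h₁ : HasPolynomialIVP L₁) (h₂ : HasPolynomialIVP L₂)
    {φ₁ : k →+* L₁} (hφ₁ : StrictMono φ₁) {φ₂ : k →+* L₂} (hφ₂ : StrictMono φ₂)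
    {p : k[X]} {x : L₁} (hx : p.eval₂ φ₁ x = 0) {a b m : k} (ha : φ₁ a < x) (hb : x < φ₁ b)
    (hm : m ∈ Set.Ioo a b) (hm0 : 0 < (derivative p).eval m)
    (hR₁ : (derivative p).RootsInRange φ₁) (hR₂ : (derivative p).RootsInRange φ₂)
    (hR : ∀ r ∈ Set.Ioo a b, (derivative p).eval r ≠ 0) :
    ∃ y, p.eval₂ φ₂ y = 0 ∧ ∀ s, (φ₁ s < x ↔ φ₂ s < y) ∧ (x < φ₁ s ↔ y < φ₂ s) := by
  have hab : a < b := hm.1.trans hm.2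
  have m₁ := h₁.strictMonoOn_eval₂ hφ₁ hm hm0 hR₁ hR
  have m₂ := h₂.strictMonoOn_eval₂ hφ₂ hm hm0 hR₂ hR
  have neg₁ : ∀ s, p.eval₂ φ₁ (φ₁ s) < 0 ↔ p.eval s < 0 := fun s => by
    rw [Polynomial.eval₂_at_apply, ← map_zero φ₁, hφ₁.lt_iff_lt]
  have pos₁ : ∀ s, 0 < p.eval₂ φ₁ (φ₁ s) ↔ 0 < p.eval s := fun s => by
    rw [Polynomial.eval₂_at_apply, ← map_zero φ₁, hφ₁.lt_iff_lt]
  have neg₂ : ∀ s, p.eval₂ φ₂ (φ₂ s) < 0 ↔ p.eval s < 0 := fun s => by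
    rw [Polynomial.eval₂_at_apply, ← map_zero φ₂, hφ₂.lt_iff_lt]
  have pos₂ : ∀ s, 0 < p.eval₂ φ₂ (φ₂ s) ↔ 0 < p.eval s := fun s => by
    rw [Polynomial.eval₂_at_apply, ← map_zero φ₂, hφ₂.lt_iff_lt]
  have hxI : x ∈ Set.Icc (φ₁ a) (φ₁ b) := ⟨ha.le, hb.le⟩
  have hpa : p.eval a < 0 := by
    rw [← neg₁, ← hx]
    exact m₁ ⟨le_rfl, ha.le.trans hb.le⟩ hxI ha
  have hpb : 0 < p.eval b := by
    rw [← pos₁, ← hx]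
    exact m₁ hxI ⟨ha.le.trans hb.le, le_rfl⟩ hb
  obtain ⟨y, hyI, hy⟩ := h₂ (p.map φ₂) (hφ₂ hab)
    (by rwa [← Polynomial.eval₂_eq_eval_map, neg₂])
    (by rwa [← Polynomial.eval₂_eq_eval_map, pos₂])
  rw [← Polynomial.eval₂_eq_eval_map] at hy
  have hyI' := Set.Ioo_subset_Icc_self hyI
  refine ⟨y, hy, fun s => ?_⟩
  rcases le_or_gt s a with hsa | hsa
  · have e₁ := (hφ₁.monotone hsa).trans_lt ha
    have e₂ := (hφ₂.monotone hsa).trans_lt hyI.1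
    exact ⟨iff_of_true e₁ e₂, iff_of_false e₁.not_gt e₂.not_gt⟩
  rcases le_or_gt b s with hsb | hsb
  · have e₁ := hb.trans_le (hφ₁.monotone hsb)
    have e₂ := hyI.2.trans_le (hφ₂.monotone hsb)
    exact ⟨iff_of_false e₁.not_gt e₂.not_gt, iff_of_true e₁ e₂⟩
  have s₁ : φ₁ s ∈ Set.Icc (φ₁ a) (φ₁ b) := ⟨(hφ₁ hsa).le, (hφ₁ hsb).le⟩
  have s₂ : φ₂ s ∈ Set.Icc (φ₂ a) (φ₂ b) := ⟨(hφ₂ hsa).le, (hφ₂ hsb).le⟩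
  rw [← m₁.lt_iff_lt s₁ hxI, ← m₁.lt_iff_lt hxI s₁, ← m₂.lt_iff_lt s₂ hyI',
    ← m₂.lt_iff_lt hyI' s₂]
  simp only [hx, hy, neg₁, neg₂, pos₁, pos₂, and_self]

theorem exists_sameCut (h₁ : HasPolynomialIVP L₁) (h₂ : HasPolynomialIVP L₂)
    {φ₁ : k →+* L₁} (hφ₁ : StrictMono φ₁) {φ₂ : k →+* L₂} (hφ₂ : StrictMono φ₂)
    {p : k[X]} (hp : p ≠ 0) {x : L₁} (hx : p.eval₂ φ₁ x = 0) (hxk : ∀ s, φ₁ s ≠ x)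
    (hR₁ : (derivative p).RootsInRange φ₁) (hR₂ : (derivative p).RootsInRange φ₂) :
    ∃ y, p.eval₂ φ₂ y = 0 ∧ ∀ s, (φ₁ s < x ↔ φ₂ s < y) ∧ (x < φ₁ s ↔ y < φ₂ s) := by
  classical
  have hd := Polynomial.derivative_ne_zero_of_eval₂_eq_zero hp hx
  obtain ⟨v, hv⟩ := Polynomial.exists_abs_lt_map_of_eval₂_eq_zero hφ₁ hp hx
  rw [abs_lt, ← map_neg] at hv
  obtain ⟨a, b, ha, hb, hR⟩ := exists_isolating hφ₁ (derivative p).roots.toFinset x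
    (fun r _ => hxk r) hv.1 hv.2
  have hR' : ∀ r ∈ Set.Ioo a b, (derivative p).eval r ≠ 0 := fun r hr hr0 =>
    hR r (by simpa [hd] using hr0) hr
  obtain ⟨m, hm⟩ := exists_between (hφ₁.lt_iff_lt.1 (ha.trans hb))
  rcases (hR' m hm).lt_or_gt with h | h
  · obtain ⟨y, hy, hcut⟩ := exists_sameCut_of_derivative_pos h₁ h₂ hφ₁ hφ₂ (p := -p)
      (by simpa using hx) ha hb hm (by simpa using h)
      (by simpa [RootsInRange] using hR₁) (by simpa [RootsInRange] using hR₂) (by simpa using hR')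
    exact ⟨y, by simpa using hy, hcut⟩
  · exact exists_sameCut_of_derivative_pos h₁ h₂ hφ₁ hφ₂ hx ha hb hm h hR₁ hR₂ hR'

theorem sign_eval₂_eq_of_sameCut (h₁ : HasPolynomialIVP L₁) (h₂ : HasPolynomialIVP L₂)
    {φ₁ : k →+* L₁} (hφ₁ : StrictMono φ₁) {φ₂ : k →+* L₂} (hφ₂ : StrictMono φ₂)
    {x : L₁} {y : L₂} (hxk : ∀ s, φ₁ s ≠ x)
    (hcut : ∀ s, (φ₁ s < x ↔ φ₂ s < y) ∧ (x < φ₁ s ↔ y < φ₂ s)) {q : k[X]} (hq : q ≠ 0)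
    (hR₁ : q.RootsInRange φ₁) (hR₂ : q.RootsInRange φ₂) :
    SignType.sign (q.eval₂ φ₁ x) = SignType.sign (q.eval₂ φ₂ y) := by
  classical
  obtain ⟨m, hm⟩ := exists_same_side hφ₁ q.roots.toFinset x fun r _ => hxk r
  simp only [Multiset.mem_toFinset, Polynomial.mem_roots hq, Polynomial.IsRoot] at hm
  have hyk : ∀ s, φ₂ s ≠ y := by
    rintro s rfl
    rcases (hxk s).lt_or_gt with h | h
    · exact lt_irrefl _ ((hcut s).1.1 h)
    · exact lt_irrefl _ ((hcut s).2.1 h)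
  rw [h₁.sign_eval₂_eq hφ₁ hR₁ (m := m) fun r hr => ⟨hxk r, hm r hr⟩,
    h₂.sign_eval₂_eq hφ₂ hR₂ (m := m) fun r hr => ⟨hyk r, (hm r hr).1, by
      rw [(hm r hr).2, (hcut r).1]⟩]

/-- `k` has no common simple extension inside `L₁` and `L₂` with matching signs. -/
def IsSignMaximal (φ₁ : k →+* L₁) (φ₂ : k →+* L₂) : Prop :=
  ∀ x y, (∀ q : k[X], SignType.sign (q.eval₂ φ₁ x) = SignType.sign (q.eval₂ φ₂ y)) →
    (∃ r, φ₁ r = x) ∧ ∃ r, φ₂ r = y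

omit [IsStrictOrderedRing k] [IsStrictOrderedRing L₁] [IsStrictOrderedRing L₂] [LinearOrder k] in
theorem IsSignMaximal.symm {φ₁ : k →+* L₁} {φ₂ : k →+* L₂} (h : IsSignMaximal φ₁ φ₂) :
    IsSignMaximal φ₂ φ₁ :=
  fun x y hxy => (h y x fun q => (hxy q).symm).symm

theorem IsSignMaximal.rootsInRange_step {φ₁ : k →+* L₁} {φ₂ : k →+* L₂}
    (hmax : IsSignMaximal φ₁ φ₂) (h₁ : HasPolynomialIVP L₁) (h₂ : HasPolynomialIVP L₂)
    (hφ₁ : StrictMono φ₁) (hφ₂ : StrictMono φ₂) {p : k[X]} (hp : p ≠ 0)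
    (ih : ∀ q : k[X], q ≠ 0 → q.degree < p.degree → q.RootsInRange φ₁ ∧ q.RootsInRange φ₂) :
    p.RootsInRange φ₁ := by
  intro x hx
  by_contra! hxk
  have hR : (derivative p).RootsInRange φ₁ ∧ (derivative p).RootsInRange φ₂ :=
    ih _ (Polynomial.derivative_ne_zero_of_eval₂_eq_zero hp hx)
      (Polynomial.degree_derivative_lt hp)
  obtain ⟨y, hy, hcut⟩ := exists_sameCut h₁ h₂ hφ₁ hφ₂ hp hx hxk hR.1 hR.2
  suffices hsign : ∀ g : k[X], SignType.sign (g.eval₂ φ₁ x) = SignType.sign (g.eval₂ φ₂ y) by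
    obtain ⟨r, hr⟩ := (hmax x y hsign).1
    exact hxk r hr
  intro g
  have hg := EuclideanDomain.div_add_mod g p
  rw [← hg]
  simp only [Polynomial.eval₂_add, Polynomial.eval₂_mul, hx, hy, zero_mul, zero_add]
  by_cases h0 : g % p = 0
  · simp [h0]
  · have := ih _ h0 (EuclideanDomain.mod_lt g hp)
    exact sign_eval₂_eq_of_sameCut h₁ h₂ hφ₁ hφ₂ hxk hcut h0 this.1 this.2

theorem IsSignMaximal.rootsInRange {φ₁ : k →+* L₁} {φ₂ : k →+* L₂}
    (hmax : IsSignMaximal φ₁ φ₂) (h₁ : HasPolynomialIVP L₁) (h₂ : HasPolynomialIVP L₂)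
    (hφ₁ : StrictMono φ₁) (hφ₂ : StrictMono φ₂) {p : k[X]} (hp : p ≠ 0) :
    p.RootsInRange φ₁ ∧ p.RootsInRange φ₂ := by
  induction hd : p.degree using WellFoundedLT.induction generalizing p with
  | ind d ih =>
    subst hd
    have ih' : ∀ q : k[X], q ≠ 0 → q.degree < p.degree →
        q.RootsInRange φ₁ ∧ q.RootsInRange φ₂ := fun q hq hlt => ih _ hlt hq rfl
    exact ⟨hmax.rootsInRange_step h₁ h₂ hφ₁ hφ₂ hp ih',
      hmax.symm.rootsInRange_step h₂ h₁ hφ₂ hφ₁ hp fun q hq hlt => (ih' q hq hlt).symm⟩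

theorem IsSignMaximal.exists_sign_eq {φ₁ : k →+* L₁} {φ₂ : k →+* L₂}
    (hmax : IsSignMaximal φ₁ φ₂) (h₁ : HasPolynomialIVP L₁) (h₂ : HasPolynomialIVP L₂)
    (hφ₁ : StrictMono φ₁) (hφ₂ : StrictMono φ₂) (Q : Finset k[X]) (x : L₁) :
    ∃ y, ∀ q ∈ Q, SignType.sign (q.eval₂ φ₁ x) = SignType.sign (q.eval₂ φ₂ y) := by
  classical
  suffices ∃ m : k, ∀ q ∈ Q, SignType.sign (q.eval₂ φ₁ x) = SignType.sign (q.eval m) by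
    obtain ⟨m, hm⟩ := this
    refine ⟨φ₂ m, fun q hq => ?_⟩
    rw [hm q hq, Polynomial.eval₂_at_apply, hφ₂.sign_map_ringHom]
  by_cases hxk : ∃ s, φ₁ s = x
  · obtain ⟨s, rfl⟩ := hxk
    exact ⟨s, fun q _ => by rw [Polynomial.eval₂_at_apply, hφ₁.sign_map_ringHom]⟩
  push Not at hxk
  obtain ⟨m, hm⟩ := exists_same_side hφ₁ (Q.biUnion fun q => q.roots.toFinset) x fun r _ => hxk r
  refine ⟨m, fun q hq => ?_⟩
  by_cases hq0 : q = 0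
  · simp [hq0]
  refine h₁.sign_eval₂_eq hφ₁ (hmax.rootsInRange h₁ h₂ hφ₁ hφ₂ hq0).1 fun r hr => ⟨hxk r, hm r ?_⟩
  simp only [Finset.mem_biUnion, Multiset.mem_toFinset]
  exact ⟨q, hq, by simpa [hq0] using hr⟩

end TwoExtensions

section SignMatching

open Polynomial (eval₂)

variable {L₁ L₂ : Type*} [Field L₁] [LinearOrder L₁] [IsStrictOrderedRing L₁]
  [Field L₂] [LinearOrder L₂] [IsStrictOrderedRing L₂]

/-- The two coordinates of each element of the subring `S` have the same sign. -/
def Subring.SignMatching (S : Subring (L₁ × L₂)) : Prop :=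
  ∀ s ∈ S, SignType.sign s.1 = SignType.sign s.2

omit [IsStrictOrderedRing L₁] [IsStrictOrderedRing L₂] in
theorem Subring.SignMatching.exists_maximal {S₀ : Subring (L₁ × L₂)} (h₀ : S₀.SignMatching) :
    ∃ S, S₀ ≤ S ∧ Maximal Subring.SignMatching S := by
  refine zorn_le_nonempty₀ {S : Subring (L₁ × L₂) | S.SignMatching} ?_ S₀ h₀
  intro c hc hchain T hT
  refine ⟨sSup c, fun s hs => ?_, fun z hz => le_sSup hz⟩
  obtain ⟨U, hU, hsU⟩ := (Subring.mem_sSup_of_directedOn ⟨T, hT⟩ hchain.directedOn).1 hs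
  exact hc hU s hsU

theorem Subring.SignMatching.mem_of_mul_mem {S : Subring (L₁ × L₂)}
    (hS : Maximal Subring.SignMatching S) {s x : L₁ × L₂} (hs : s ∈ S) (hs0 : s ≠ 0)
    (hx : s * x ∈ S) : x ∈ S := by
  have hne : ∀ t ∈ S, t ≠ 0 → t.1 ≠ 0 ∧ t.2 ≠ 0 := by
    intro t ht ht0
    have := hS.prop t ht
    constructor <;> intro h <;> apply ht0 <;> rw [h, sign_zero] at this
    · exact Prod.ext h (sign_eq_zero_iff.1 this.symm)
    · exact Prod.ext (sign_eq_zero_iff.1 this) h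
  let S' : Subring (L₁ × L₂) :=
    { carrier := {y | ∃ t ∈ S, t ≠ 0 ∧ t * y ∈ S}
      mul_mem' := by
        rintro y z ⟨t, ht, ht0, hty⟩ ⟨u, hu, hu0, huz⟩
        refine ⟨t * u, mul_mem ht hu, fun h => ?_, ?_⟩
        · exact mul_ne_zero (hne t ht ht0).1 (hne u hu hu0).1 (congrArg Prod.fst h)
        · rw [mul_mul_mul_comm]; exact mul_mem hty huz
      one_mem' := ⟨1, one_mem _, one_ne_zero, by simp [one_mem]⟩
      add_mem' := by
        rintro y z ⟨t, ht, ht0, hty⟩ ⟨u, hu, hu0, huz⟩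
        refine ⟨t * u, mul_mem ht hu, fun h => ?_, ?_⟩
        · exact mul_ne_zero (hne t ht ht0).1 (hne u hu hu0).1 (congrArg Prod.fst h)
        · have : t * u * (y + z) = u * (t * y) + t * (u * z) := by ring
          rw [this]; exact add_mem (mul_mem hu hty) (mul_mem ht huz)
      zero_mem' := ⟨1, one_mem _, one_ne_zero, by simp [zero_mem]⟩
      neg_mem' := by
        rintro y ⟨t, ht, ht0, hty⟩
        exact ⟨t, ht, ht0, by rw [mul_neg]; exact neg_mem hty⟩ }
  have hle : S ≤ S' := fun y hy => ⟨1, one_mem _, one_ne_zero, by simpa using hy⟩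
  refine hS.le_of_ge (y := S') ?_ hle ⟨s, hs, hs0, hx⟩
  rintro y ⟨t, ht, ht0, hty⟩
  have e₁ := hS.prop t ht
  have e₂ := hS.prop _ hty
  rw [Prod.fst_mul, Prod.snd_mul, sign_mul, sign_mul, e₁] at e₂
  exact mul_left_cancel₀ (sign_ne_zero.2 (hne t ht ht0).2) e₂

theorem IsSignMaximal.exists_sign_eq_of_sign_map_eq {k : Type*} [Field k]
    {φ₁ : k →+* L₁} {φ₂ : k →+* L₂} (hmax : IsSignMaximal φ₁ φ₂)
    (h₁ : HasPolynomialIVP L₁) (h₂ : HasPolynomialIVP L₂)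
    (hφ : ∀ s, SignType.sign (φ₁ s) = SignType.sign (φ₂ s)) (Q : Finset k[X]) (x : L₁) :
    ∃ y, ∀ q ∈ Q, SignType.sign (q.eval₂ φ₁ x) = SignType.sign (q.eval₂ φ₂ y) := by
  let _ : LinearOrder k := LinearOrder.lift' φ₁ φ₁.injective
  have hφ₁ : StrictMono φ₁ := fun _ _ h => h
  have : IsStrictOrderedRing k :=
    Function.Injective.isStrictOrderedRing φ₁ (map_zero _) (map_one _) (map_add _) (map_mul _)
      Iff.rfl Iff.rfl
  have hφ₂ : StrictMono φ₂ := by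
    intro a b hab
    have hsign := hφ (b - a)
    have hpos : 0 < φ₁ (b - a) := by rw [map_sub]; exact sub_pos.2 (hφ₁ hab)
    rw [sign_pos hpos, eq_comm, sign_eq_one_iff, map_sub] at hsign
    exact sub_pos.1 hsign
  exact hmax.exists_sign_eq h₁ h₂ hφ₁ hφ₂ Q x

theorem exists_eval₂_sign_eq (h₁ : HasPolynomialIVP L₁) (h₂ : HasPolynomialIVP L₂)
    {A : Type*} [CommRing A] (ψ₁ : A →+* L₁) (ψ₂ : A →+* L₂)
    (hψ : ∀ a, SignType.sign (ψ₁ a) = SignType.sign (ψ₂ a)) (Q : Finset A[X]) (x : L₁) :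
    ∃ y, ∀ q ∈ Q, SignType.sign (q.eval₂ ψ₁ x) = SignType.sign (q.eval₂ ψ₂ y) := by
  classical
  have h₀ : (ψ₁.prod ψ₂).range.SignMatching := by rintro _ ⟨a, rfl⟩; exact hψ a
  obtain ⟨S, hS₀, hS⟩ := h₀.exists_maximal
  have hfield : IsField S :=
    { exists_pair_ne := ⟨0, 1, zero_ne_one⟩
      mul_comm := mul_comm
      mul_inv_cancel := by
        intro a ha
        have ha0 : (a : L₁ × L₂) ≠ 0 := by simpa using ha
        have hsign := hS.prop a a.2
        have n₁ : (a : L₁ × L₂).1 ≠ 0 := by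
          intro h; rw [h, sign_zero] at hsign
          exact ha0 (Prod.ext h (sign_eq_zero_iff.1 hsign.symm))
        have n₂ : (a : L₁ × L₂).2 ≠ 0 := by
          intro h; rw [h, sign_zero] at hsign
          exact ha0 (Prod.ext (sign_eq_zero_iff.1 hsign) h)
        have hmul : (a : L₁ × L₂) * ((a : L₁ × L₂).1⁻¹, (a : L₁ × L₂).2⁻¹) = 1 :=
          Prod.ext (mul_inv_cancel₀ n₁) (mul_inv_cancel₀ n₂)
        exact ⟨⟨_, Subring.SignMatching.mem_of_mul_mem hS a.2 ha0 (hmul ▸ one_mem S)⟩,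
          Subtype.ext hmul⟩ }
  let _ : Field S := hfield.toField
  let φ₁ : S →+* L₁ := (RingHom.fst L₁ L₂).comp S.subtype
  let φ₂ : S →+* L₂ := (RingHom.snd L₁ L₂).comp S.subtype
  have hmax : IsSignMaximal φ₁ φ₂ := by
    intro x y hxy
    let ev : S[X] →+* L₁ × L₂ := (Polynomial.eval₂RingHom φ₁ x).prod (Polynomial.eval₂RingHom φ₂ y)
    have hle : S ≤ ev.range := fun s hs => ⟨Polynomial.C ⟨s, hs⟩, by
      simp only [ev, RingHom.prod_apply, Polynomial.coe_eval₂RingHom, Polynomial.eval₂_C]; rfl⟩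
    have hmatch : ev.range.SignMatching := by rintro _ ⟨q, rfl⟩; exact hxy q
    have hmem : (x, y) ∈ S := hS.le_of_ge hmatch hle ⟨Polynomial.X, by simp [ev]⟩
    exact ⟨⟨⟨_, hmem⟩, rfl⟩, ⟨⟨_, hmem⟩, rfl⟩⟩
  let j : A →+* S := (ψ₁.prod ψ₂).codRestrict S fun a => hS₀ ⟨a, rfl⟩
  obtain ⟨y, hy⟩ := hmax.exists_sign_eq_of_sign_map_eq h₁ h₂
    (fun s => hS.prop s s.2) (Q.image (Polynomial.map j)) x
  refine ⟨y, fun q hq => ?_⟩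
  have := hy _ (Finset.mem_image_of_mem _ hq)
  rwa [Polynomial.eval₂_map, Polynomial.eval₂_map] at this

end SignMatching

section Transfer

open Filter

theorem Real.hasPolynomialIVP : HasPolynomialIVP ℝ := by
  intro p a b hab ha hb
  exact intermediate_value_Ioo hab.le p.continuous.continuousOn ⟨ha, hb⟩

theorem Filter.Germ.coeRingHom_surjective {ι : Type*} (l : Filter ι) :
    Function.Surjective (Germ.coeRingHom l : (ι → ℝ) →+* Germ l ℝ) :=
  fun x => x.inductionOn fun f => ⟨f, rfl⟩

theorem Filter.Germ.eval_map_coe {ι : Type*} (l : Filter ι) (P : (ι → ℝ)[X]) (x : ι → ℝ) :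
    (P.map (Germ.coeRingHom l)).eval (x : Germ l ℝ) =
      ((fun i => (P.map (Pi.evalRingHom (fun _ => ℝ) i)).eval (x i) : ι → ℝ) : Germ l ℝ) := by
  have h : (P.map (Germ.coeRingHom l)).eval (x : Germ l ℝ) = Germ.coeRingHom l (P.eval x) := by
    rw [← Polynomial.eval₂_at_apply, Polynomial.eval₂_eq_eval_map]; rfl
  rw [h]
  refine congrArg (Germ.coeRingHom l) (funext fun i => ?_)
  have := Polynomial.eval₂_at_apply (p := P) (Pi.evalRingHom (fun _ => ℝ) i) x
  rw [Polynomial.eval₂_eq_eval_map] at this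
  exact this.symm

theorem Filter.Germ.hasPolynomialIVP {ι : Type*} (l : Ultrafilter ι) :
    HasPolynomialIVP (Germ (l : Filter ι) ℝ) := by
  intro p a b
  obtain ⟨P, rfl⟩ := Polynomial.map_surjective _ (Germ.coeRingHom_surjective (l : Filter ι)) p
  induction a using Germ.inductionOn with | _ a
  induction b using Germ.inductionOn with | _ b
  rw [Germ.eval_map_coe, Germ.eval_map_coe, Germ.coe_lt, Germ.coe_pos, ← Germ.coe_zero]
  intro hab ha hb
  replace ha := Germ.coe_lt.1 ha
  have hex : ∀ᶠ i in (l : Filter ι), ∃ c ∈ Set.Ioo (a i) (b i),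
      (P.map (Pi.evalRingHom (fun _ => ℝ) i)).eval c = 0 := by
    filter_upwards [hab, ha, hb] with i h1 h2 h3
    exact Real.hasPolynomialIVP _ h1 h2 h3
  obtain ⟨c, hc⟩ := hex.choice
  refine ⟨(c : Germ (l : Filter ι) ℝ), ⟨?_, ?_⟩, ?_⟩
  · exact Germ.coe_lt.2 (hc.mono fun i h => h.1.1)
  · exact Germ.coe_lt.2 (hc.mono fun i h => h.1.2)
  · rw [Germ.eval_map_coe]
    exact Germ.coe_eq.2 (hc.mono fun i h => h.2)

theorem Filter.Germ.sign_coe_eq {ι : Type*} (l : Ultrafilter ι) (f : ι → ℝ) (s : SignType) :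
    SignType.sign (f : Germ (l : Filter ι) ℝ) = s ↔ ∀ᶠ i in (l : Filter ι),
      SignType.sign (f i) = s := by
  cases s
  · change SignType.sign _ = 0 ↔ ∀ᶠ i in (l : Filter ι), SignType.sign (f i) = 0
    simp only [sign_eq_zero_iff]
    exact Germ.coe_eq
  · change SignType.sign _ = -1 ↔ ∀ᶠ i in (l : Filter ι), SignType.sign (f i) = -1
    simp only [sign_eq_neg_one_iff]
    exact Germ.coe_lt
  · change SignType.sign _ = 1 ↔ ∀ᶠ i in (l : Filter ι), SignType.sign (f i) = 1
    simp only [sign_eq_one_iff]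
    exact Germ.coe_pos

theorem sign_map_real {L : Type*} [Field L] [LinearOrder L] [IsStrictOrderedRing L]
    (φ : ℝ →+* L) (r : ℝ) : SignType.sign (φ r) = SignType.sign r := by
  refine StrictMono.sign_map_ringHom (fun a b hab => ?_) r
  have hpos : 0 < b - a := sub_pos.2 hab
  rw [← sub_pos, ← map_sub, ← Real.mul_self_sqrt hpos.le, map_mul]
  exact mul_self_pos.2 ((map_ne_zero φ).2 (Real.sqrt_pos.2 hpos).ne')

theorem MvPolynomial.eval₂_finSuccEquiv {S : Type*} [CommRing S] {n : ℕ}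
    (φ : MvPolynomial (Fin (n + 1)) ℝ →+* S) (q : MvPolynomial (Fin (n + 1)) ℝ) :
    (MvPolynomial.finSuccEquiv ℝ n q).eval₂ (φ.comp (MvPolynomial.rename Fin.succ).toRingHom)
      (φ (MvPolynomial.X 0)) = φ q := by
  refine DFunLike.congr_fun (f := (Polynomial.eval₂RingHom
    (φ.comp (MvPolynomial.rename Fin.succ).toRingHom) (φ (MvPolynomial.X 0))).comp
      (MvPolynomial.finSuccEquiv ℝ n : _ →+* _)) (g := φ)
      (MvPolynomial.ringHom_ext (fun r => ?_) (Fin.cases ?_ fun i => ?_)) q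
  · simp [MvPolynomial.finSuccEquiv_apply]
  · simp [MvPolynomial.finSuccEquiv_X_zero]
  · simp [MvPolynomial.finSuccEquiv_X_succ]

/-- Finitely many sign conditions on a point over an ordered field with the intermediate value
property are satisfied by a real point. -/
theorem exists_real_point_sign_eq {L : Type*} [Field L] [LinearOrder L] [IsStrictOrderedRing L]
    (hL : HasPolynomialIVP L) (n : ℕ) (φ : MvPolynomial (Fin n) ℝ →+* L)
    (Q : Finset (MvPolynomial (Fin n) ℝ)) :
    ∃ a : Fin n → ℝ, ∀ q ∈ Q, SignType.sign (φ q) = SignType.sign (eval a q) := by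
  classical
  induction n with
  | zero =>
    refine ⟨0, fun q _ => ?_⟩
    rw [MvPolynomial.eq_C_of_isEmpty q, MvPolynomial.eval_C]
    exact sign_map_real (φ.comp MvPolynomial.C) _
  | succ n ih =>
    let e := MvPolynomial.finSuccEquiv ℝ n
    let ψ : MvPolynomial (Fin n) ℝ →+* L := φ.comp (MvPolynomial.rename Fin.succ).toRingHom
    choose a ha using ih ψ
    let l : Ultrafilter (Finset (MvPolynomial (Fin n) ℝ)) := Ultrafilter.of atTop
    let ψ₂ : MvPolynomial (Fin n) ℝ →+* Germ (l : Filter (Finset (MvPolynomial (Fin n) ℝ))) ℝ :=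
      (Germ.coeRingHom _).comp (RingHom.pi fun B => eval (a B))
    have hψ : ∀ q, SignType.sign (ψ q) = SignType.sign (ψ₂ q) := by
      intro q
      refine ((Germ.sign_coe_eq l (fun B => eval (a B) q) _).2 ?_).symm
      have hge : ∀ᶠ B : Finset (MvPolynomial (Fin n) ℝ) in atTop, q ∈ B := by
        filter_upwards [eventually_ge_atTop ({q} : Finset (MvPolynomial (Fin n) ℝ))] with B hB
        exact Finset.singleton_subset_iff.1 hB
      exact (hge.filter_mono (Ultrafilter.of_le atTop)).mono fun B hB => (ha B q hB).symm
    obtain ⟨y, hy⟩ := exists_eval₂_sign_eq hL (Germ.hasPolynomialIVP l) ψ ψ₂ hψ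
      (Q.image e) (φ (MvPolynomial.X 0))
    obtain ⟨y, rfl⟩ := Germ.coeRingHom_surjective _ y
    let G : MvPolynomial (Fin (n + 1)) ℝ →+* Germ (l : Filter (Finset (MvPolynomial (Fin n) ℝ))) ℝ :=
      (Germ.coeRingHom _).comp
        (RingHom.pi fun B => eval (Fin.cons (y B) (a B) : Fin (n + 1) → ℝ))
    have hG : G.comp (MvPolynomial.rename Fin.succ).toRingHom = ψ₂ := by
      refine RingHom.ext fun q => congrArg (Germ.coeRingHom _) (funext fun B => ?_)
      exact (MvPolynomial.eval_rename _ _ _).trans (by rw [Fin.cons_comp_succ]; rfl)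
    have hG₀ : G (MvPolynomial.X 0) = Germ.coeRingHom _ y :=
      congrArg (Germ.coeRingHom _) (funext fun B => by simp)
    have hall : ∀ᶠ B in (l : Filter (Finset (MvPolynomial (Fin n) ℝ))), ∀ q ∈ Q, SignType.sign (φ q) =
        SignType.sign (eval (Fin.cons (y B) (a B) : Fin (n + 1) → ℝ) q) := by
      rw [Filter.eventually_all_finset]
      intro q hq
      have h1 := hy _ (Finset.mem_image_of_mem e hq)
      rw [MvPolynomial.eval₂_finSuccEquiv, ← hG, ← hG₀, MvPolynomial.eval₂_finSuccEquiv] at h1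
      exact ((Germ.sign_coe_eq l _ _).1 h1.symm).mono fun B hB => hB.symm
    obtain ⟨B, hB⟩ := hall.exists
    exact ⟨_, hB⟩

end Transfer

section ExistsOrdering

variable {R : Type*} [CommRing R]

/-- The subsemiring generated by `P` and `a`, when `P` contains the squares. -/
def RingPreordering.adjoin (P : RingPreordering R) (a : R) : Subsemiring R where
  carrier := {x | ∃ t ∈ P, ∃ s ∈ P, x = t + a * s}
  mul_mem' := by
    rintro _ _ ⟨t, ht, s, hs, rfl⟩ ⟨u, hu, v, hv, rfl⟩
    refine ⟨t * u + a * a * (s * v), ?_, t * v + s * u, ?_, by ring⟩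
    · exact add_mem (mul_mem ht hu) (mul_mem (P.mul_self_mem a) (mul_mem hs hv))
    · exact add_mem (mul_mem ht hv) (mul_mem hs hu)
  one_mem' := ⟨1, one_mem P, 0, zero_mem P, by simp⟩
  add_mem' := by
    rintro _ _ ⟨t, ht, s, hs, rfl⟩ ⟨u, hu, v, hv, rfl⟩
    exact ⟨t + u, add_mem ht hu, s + v, add_mem hs hv, by ring⟩
  zero_mem' := ⟨0, zero_mem P, 0, zero_mem P, by simp⟩

theorem Subsemiring.exists_isOrdering (T : Subsemiring R) (hT : ∀ x : R, x * x ∈ T)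
    (M : Submonoid R) (hM : ∀ m ∈ M, -(m * m) ∉ T) :
    ∃ P : RingPreordering R, T ≤ P.toSubsemiring ∧ (∀ m ∈ M, -(m * m) ∉ P) ∧ P.IsOrdering := by
  obtain ⟨U, hTU, hU⟩ : ∃ U, T ≤ U ∧
      Maximal (fun U : Subsemiring R => ∀ m ∈ M, -(m * m) ∉ U) U := by
    refine zorn_le_nonempty₀ {U : Subsemiring R | ∀ m ∈ M, -(m * m) ∉ U} ?_ T hM
    intro c hc hchain V hV
    refine ⟨sSup c, fun m hm hmem => ?_, fun z hz => le_sSup hz⟩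
    obtain ⟨W, hW, hmW⟩ := (Subsemiring.mem_sSup_of_directedOn ⟨V, hV⟩ hchain.directedOn).1 hmem
    exact hc hW m hm hmW
  let P : RingPreordering R := RingPreordering.mk' U (fun hx hy => add_mem hx hy)
    (fun hx hy => mul_mem hx hy) (fun x => hTU (hT x))
    (by simpa using hU.prop 1 (one_mem M))
  have key : ∀ a, a ∉ P → ∃ m ∈ M, ∃ t ∈ P, ∃ s ∈ P, -(m * m) = t + a * s := by
    intro a ha
    by_contra! hcon
    refine ha (hU.le_of_ge (y := P.adjoin a) ?_ ?_ ⟨0, zero_mem P, 1, one_mem P, by simp⟩)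
    · rintro m hm ⟨t, ht, s, hs, h⟩
      exact hcon m hm t ht s hs h
    · exact fun x hx => ⟨x, hx, 0, zero_mem P, by simp⟩
  refine ⟨P, hTU, hU.prop, RingPreordering.isOrdering_iff.2 fun a b hab => ?_⟩
  by_contra! hcon
  obtain ⟨m, hm, t, ht, s, hs, h₁⟩ := key a hcon.1
  obtain ⟨n, hn, u, hu, v, hv, h₂⟩ := key b hcon.2
  refine hU.prop (m * n) (mul_mem hm hn) ?_
  have heq : -(m * n * (m * n)) =
      m * m * u + n * n * t + t * u + -(a * b) * (s * v) := by
    linear_combination (n * n + u) * h₁ - (a * s) * h₂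
  rw [heq]
  have sq : ∀ x, x * x ∈ P := P.mul_self_mem
  exact add_mem (add_mem (add_mem (mul_mem (sq m) hu) (mul_mem (sq n) ht)) (mul_mem ht hu))
    (mul_mem hab (mul_mem hs hv))

end ExistsOrdering

section IVPOfMaximal

variable {F : Type*} [Field F] [LinearOrder F]

/-- The multiplicative monoid of products of a nonnegative constant and a square. -/
def Polynomial.weightedSquares (F : Type*) [Field F] [LinearOrder F] [IsStrictOrderedRing F] :
    Submonoid F[X] where
  carrier := {q | ∃ t : F, 0 ≤ t ∧ ∃ g : F[X], q = Polynomial.C t * (g * g)}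
  mul_mem' := by
    rintro _ _ ⟨t, ht, g, rfl⟩ ⟨u, hu, k, rfl⟩
    exact ⟨t * u, mul_nonneg ht hu, g * k, by rw [Polynomial.C_mul]; ring⟩
  one_mem' := ⟨1, zero_le_one, 1, by simp⟩

variable [IsStrictOrderedRing F]

theorem Polynomial.eval_nonneg_of_mem_closure_weightedSquares {s : F[X]}
    (hs : s ∈ (Polynomial.weightedSquares F).subsemiringClosure) (x : F) : 0 ≤ s.eval x := by
  rw [Submonoid.subsemiringClosure_mem] at hs
  induction hs using AddSubmonoid.closure_induction with
  | mem s hs =>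
    obtain ⟨t, ht, g, rfl⟩ := hs
    simpa using mul_nonneg ht (mul_self_nonneg (g.eval x))
  | zero => simp
  | add s u _ _ hs hu => rw [Polynomial.eval_add]; exact add_nonneg hs hu

theorem Polynomial.exists_natDegree_le_of_mem_closure_weightedSquares {p : F[X]}
    (hp : p.natDegree ≠ 0) {s : F[X]}
    (hs : s ∈ (Polynomial.weightedSquares F).subsemiringClosure) :
    ∃ u ∈ (Polynomial.weightedSquares F).subsemiringClosure,
      u.natDegree ≤ 2 * (p.natDegree - 1) ∧ p ∣ s - u := by
  rw [Submonoid.subsemiringClosure_mem] at hs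
  induction hs using AddSubmonoid.closure_induction with
  | mem s hs =>
    obtain ⟨t, ht, g, rfl⟩ := hs
    refine ⟨Polynomial.C t * (g % p * (g % p)), ?_, ?_, ?_⟩
    · exact (Submonoid.subsemiringClosure_mem _).2 (AddSubmonoid.subset_closure ⟨t, ht, g % p, rfl⟩)
    · have h := Nat.le_sub_one_of_lt (Polynomial.natDegree_mod_lt g hp)
      refine (Polynomial.natDegree_C_mul_le _ _).trans (Polynomial.natDegree_mul_le.trans ?_)
      lia
    · refine ⟨Polynomial.C t * (g / p) * (g + g % p), ?_⟩
      linear_combination (-Polynomial.C t * (g + g % p)) * EuclideanDomain.div_add_mod g p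
  | zero => exact ⟨0, zero_mem _, by simp, by simp⟩
  | add s s' _ _ hs hs' =>
    obtain ⟨u, hu, hud, hup⟩ := hs
    obtain ⟨u', hu', hud', hup'⟩ := hs'
    refine ⟨u + u', add_mem hu hu', Polynomial.natDegree_add_le_of_degree_le hud hud', ?_⟩
    rw [add_sub_add_comm]
    exact dvd_add hup hup'

theorem Polynomial.not_dvd_one_add_of_mem_closure_weightedSquares {p : F[X]} {a b : F}
    (ha : p.eval a < 0) (hb : 0 < p.eval b)
    (ih : ∀ q : F[X], q.natDegree < p.natDegree → q.eval a < 0 → 0 < q.eval b →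
      ∃ c ∈ Set.Ioo a b, q.eval c = 0) {s : F[X]}
    (hs : s ∈ (Polynomial.weightedSquares F).subsemiringClosure) : ¬ p ∣ 1 + s := by
  intro hdvd
  have hp : p.natDegree ≠ 0 := by
    intro h
    rw [Polynomial.eq_C_of_natDegree_eq_zero h, Polynomial.eval_C] at ha hb
    exact lt_asymm ha hb
  obtain ⟨u, hu, hud, hup⟩ :=
    Polynomial.exists_natDegree_le_of_mem_closure_weightedSquares hp hs
  have hpos : ∀ x, 0 < (1 + u).eval x := by
    intro x
    have := Polynomial.eval_nonneg_of_mem_closure_weightedSquares hu x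
    rw [Polynomial.eval_add, Polynomial.eval_one]
    linarith
  obtain ⟨q, hq⟩ : p ∣ 1 + u := by
    have := dvd_sub hdvd hup
    rwa [show 1 + s - (s - u) = 1 + u by ring] at this
  have hq0 : q ≠ 0 := by
    rintro rfl
    have := hpos a
    simp [hq] at this
  have hp0 : p ≠ 0 := by rintro rfl; exact hp Polynomial.natDegree_zero
  have hdeg : q.natDegree < p.natDegree := by
    have h₁ : (1 + u).natDegree ≤ 2 * (p.natDegree - 1) :=
      Polynomial.natDegree_add_le_of_degree_le (by simp) hud
    rw [hq, Polynomial.natDegree_mul hp0 hq0] at h₁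
    lia
  have hmul : ∀ x, 0 < p.eval x * q.eval x := by
    intro x
    rw [← Polynomial.eval_mul, ← hq]
    exact hpos x
  obtain ⟨c, -, hc⟩ := ih q hdeg (neg_of_mul_pos_right (hmul a) ha.le)
    ((pos_iff_pos_of_mul_pos (hmul b)).1 hb)
  have := hmul c
  simp [hc] at this

/-- A subsemiring that is the nonnegative cone of an ordering of the subring it generates. -/
structure Subsemiring.IsOrderCone {Ω : Type*} [CommRing Ω] (T : Subsemiring Ω) : Prop where
  eq_zero : ∀ x ∈ T, -x ∈ T → x = 0
  sub_mem_or : ∀ x ∈ T, ∀ y ∈ T, x - y ∈ T ∨ y - x ∈ T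

theorem RingPreordering.isOrderCone_map {R Ω : Type*} [CommRing R] [CommRing Ω]
    (P : RingPreordering R) [P.IsOrdering] (φ : R →+* Ω)
    (hφ : ∀ x, φ x = 0 ↔ x ∈ P.support) : (P.toSubsemiring.map φ).IsOrderCone where
  eq_zero := by
    rintro _ ⟨x, hx, rfl⟩ ⟨y, hy, hxy⟩
    have hsum : x + y ∈ P.support := (hφ _).1 (by rw [map_add, hxy, add_neg_cancel])
    refine (hφ x).2 (RingPreordering.mem_support.2 ⟨hx, ?_⟩)
    have := add_mem (RingPreordering.mem_support.1 hsum).2 hy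
    rwa [neg_add, neg_add_cancel_right] at this
  sub_mem_or := by
    rintro _ ⟨x, -, rfl⟩ _ ⟨y, -, rfl⟩
    rcases mem_or_neg_mem P (x - y) with h | h
    · exact Or.inl ⟨x - y, h, map_sub φ x y⟩
    · exact Or.inr ⟨-(x - y), h, by rw [neg_sub, map_sub]⟩

theorem Irreducible.exists_root_of_maximal {Ω : Type*} [Field Ω] [IsAlgClosed Ω] (ι : F →+* Ω)
    (hι : ∀ T : Subsemiring Ω, T.IsOrderCone → (∀ x, 0 ≤ x → ι x ∈ T) →
      ∀ y ∈ T, ∃ x, ι x = y)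
    {p : F[X]} (hp : Irreducible p) {a b : F} (ha : p.eval a < 0)
    (hb : 0 < p.eval b)
    (ih : ∀ q : F[X], q.natDegree < p.natDegree → q.eval a < 0 → 0 < q.eval b →
      ∃ c ∈ Set.Ioo a b, q.eval c = 0) : ∃ x, p.eval x = 0 := by
  have : Fact (Irreducible p) := ⟨hp⟩
  let T := (Polynomial.weightedSquares F).subsemiringClosure.map (AdjoinRoot.mk p)
  have hmem : ∀ t : F, 0 ≤ t → ∀ g : F[X],
      Polynomial.C t * (g * g) ∈ (Polynomial.weightedSquares F).subsemiringClosure :=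
    fun t ht g => (Submonoid.subsemiringClosure_mem _).2
      (AddSubmonoid.subset_closure ⟨t, ht, g, rfl⟩)
  obtain ⟨P, hTP, -, hP⟩ := T.exists_isOrdering
    (fun x => by
      obtain ⟨g, rfl⟩ := AdjoinRoot.mk_surjective x
      exact ⟨_, hmem 1 zero_le_one g, by simp⟩) ⊥
    (fun m hm => by
      rw [Submonoid.mem_bot.1 hm, mul_one]
      rintro ⟨s, hs, hs1⟩
      refine Polynomial.not_dvd_one_add_of_mem_closure_weightedSquares ha hb ih hs ?_
      rw [← AdjoinRoot.mk_eq_zero, map_add, hs1, map_one, add_neg_cancel])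
  obtain ⟨α, hα⟩ := IsAlgClosed.exists_eval₂_eq_zero ι p
    (Polynomial.degree_pos_of_irreducible hp).ne'
  let φ : AdjoinRoot p →+* Ω := AdjoinRoot.lift ι α hα
  have hcone : (P.toSubsemiring.map φ).IsOrderCone := P.isOrderCone_map φ fun x => by
    rw [map_eq_zero, RingPreordering.support_eq_bot, Ideal.mem_bot]
  have hle : ∀ x, 0 ≤ x → ι x ∈ P.toSubsemiring.map φ := fun x hx =>
    ⟨AdjoinRoot.of p x, hTP ⟨_, hmem x hx 1, by simp⟩, AdjoinRoot.lift_of hα⟩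
  obtain ⟨x, hx⟩ : ∃ x, ι x = α := by
    rcases mem_or_neg_mem P (AdjoinRoot.root p) with h | h
    · exact hι _ hcone hle _ ⟨_, h, AdjoinRoot.lift_root hα⟩
    · obtain ⟨x, hx⟩ := hι _ hcone hle _ ⟨_, h, rfl⟩
      exact ⟨-x, by rw [map_neg, hx, map_neg, neg_neg]; exact AdjoinRoot.lift_root hα⟩
  refine ⟨x, ι.injective ?_⟩
  rw [map_zero, ← hα, ← hx, Polynomial.eval₂_at_apply]

theorem hasPolynomialIVP_of_maximal {Ω : Type*} [Field Ω] [IsAlgClosed Ω] (ι : F →+* Ω)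
    (hι : ∀ T : Subsemiring Ω, T.IsOrderCone → (∀ x, 0 ≤ x → ι x ∈ T) →
      ∀ y ∈ T, ∃ x, ι x = y) : HasPolynomialIVP F := by
  intro p
  induction hd : p.natDegree using Nat.strong_induction_on generalizing p with
  | _ d ih
  subst hd
  intro a b hab ha hb
  have hfactor : ∀ q r : F[X], p = q * r →
      (q.eval a * q.eval b < 0 → ∃ c ∈ Set.Ioo a b, q.eval c = 0) →
      (r.eval a * r.eval b < 0 → ∃ c ∈ Set.Ioo a b, r.eval c = 0) →
      ∃ c ∈ Set.Ioo a b, p.eval c = 0 := by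
    rintro q r rfl hq hr
    have hneg : q.eval a * q.eval b * (r.eval a * r.eval b) < 0 := by
      have := mul_neg_of_neg_of_pos ha hb
      simp only [Polynomial.eval_mul] at this
      linarith
    rcases mul_neg_iff.1 hneg with ⟨-, h⟩ | ⟨h, -⟩
    · obtain ⟨c, hc, hc0⟩ := hr h
      exact ⟨c, hc, by simp [hc0]⟩
    · obtain ⟨c, hc, hc0⟩ := hq h
      exact ⟨c, hc, by simp [hc0]⟩
  have ih' : ∀ q : F[X], q.natDegree < p.natDegree → q.eval a * q.eval b < 0 →
      ∃ c ∈ Set.Ioo a b, q.eval c = 0 := by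
    intro q hq hneg
    rcases mul_neg_iff.1 hneg with ⟨h₁, h₂⟩ | ⟨h₁, h₂⟩
    · obtain ⟨c, hc, hc0⟩ := ih (-q).natDegree (by rwa [Polynomial.natDegree_neg]) (-q) rfl hab
        (by simpa using h₁) (by simpa using h₂)
      exact ⟨c, hc, by simpa using hc0⟩
    · exact ih _ hq q rfl hab h₁ h₂
  have hp0 : p ≠ 0 := by rintro rfl; simp at ha
  have hdeg : ∀ q r : F[X], p = q * r → ¬ IsUnit r → q.natDegree < p.natDegree := by
    rintro q r rfl hr
    have hq0 := left_ne_zero_of_mul hp0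
    have hr0 := right_ne_zero_of_mul hp0
    have : r.natDegree ≠ 0 := fun h => hr (by
      rw [Polynomial.isUnit_iff_degree_eq_zero, Polynomial.degree_eq_natDegree hr0, h]; rfl)
    rw [Polynomial.natDegree_mul hq0 hr0]
    lia
  by_cases hroot : ∃ x, p.eval x = 0
  · obtain ⟨x, hx⟩ := hroot
    obtain ⟨r, hr⟩ := Polynomial.dvd_iff_isRoot.2 hx
    refine hfactor _ r hr (fun hneg => ⟨x, ?_, by simp⟩)
      (ih' r (hdeg r (Polynomial.X - Polynomial.C x) ?_ ?_))
    · simp only [Polynomial.eval_sub, Polynomial.eval_X, Polynomial.eval_C] at hneg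
      rcases mul_neg_iff.1 hneg with ⟨h₁, h₂⟩ | ⟨h₁, h₂⟩
      · linarith
      · exact ⟨by linarith, by linarith⟩
    · rw [hr, mul_comm]
    · exact Polynomial.not_isUnit_X_sub_C x
  by_cases hirr : Irreducible p
  · exact absurd (hirr.exists_root_of_maximal ι hι ha hb
      fun q hq h₁ h₂ => ih _ hq q rfl hab h₁ h₂) hroot
  · have hunit : ¬ IsUnit p := fun hu => by
      obtain ⟨c, -, rfl⟩ := Polynomial.isUnit_iff.1 hu
      simp only [Polynomial.eval_C] at ha hb
      exact lt_asymm ha hb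
    simp only [irreducible_iff, hunit, not_false_eq_true, true_and, not_forall, not_or] at hirr
    obtain ⟨q, r, hqr, hq, hr⟩ := hirr
    exact hfactor q r hqr (ih' q (hdeg q r hqr hr)) (ih' r (hdeg r q (by rw [hqr, mul_comm]) hq))

end IVPOfMaximal

section RealClosedExtension

theorem Subsemiring.IsOrderCone.exists_maximal {Ω : Type*} [CommRing Ω] {T : Subsemiring Ω}
    (hT : T.IsOrderCone) : ∃ U, T ≤ U ∧ Maximal Subsemiring.IsOrderCone U := by
  refine zorn_le_nonempty₀ {U : Subsemiring Ω | U.IsOrderCone} ?_ T hT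
  intro c hc hchain V hV
  have hmem := fun x => Subsemiring.mem_sSup_of_directedOn (x := x) ⟨V, hV⟩ hchain.directedOn
  have htwo : ∀ x ∈ sSup c, ∀ y ∈ sSup c, ∃ W ∈ c, x ∈ W ∧ y ∈ W := by
    intro x hx y hy
    obtain ⟨W₁, hW₁, hx⟩ := (hmem x).1 hx
    obtain ⟨W₂, hW₂, hy⟩ := (hmem y).1 hy
    rcases hchain.total hW₁ hW₂ with h | h
    · exact ⟨W₂, hW₂, h hx, hy⟩
    · exact ⟨W₁, hW₁, hx, h hy⟩
  refine ⟨sSup c, ⟨fun x hx hnx => ?_, fun x hx y hy => ?_⟩, fun z hz => le_sSup hz⟩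
  · obtain ⟨W, hW, h₁, h₂⟩ := htwo x hx _ hnx
    exact (hc hW).eq_zero x h₁ h₂
  · obtain ⟨W, hW, h₁, h₂⟩ := htwo x hx y hy
    exact ((hc hW).sub_mem_or x h₁ y h₂).imp (le_sSup hW ·) (le_sSup hW ·)

variable {Ω : Type*} [Field Ω] {T : Subsemiring Ω}

theorem Subsemiring.IsOrderCone.mem_of_mul_mem (hT : Maximal Subsemiring.IsOrderCone T)
    {s y : Ω} (hs : s ∈ T) (hs0 : s ≠ 0) (hy : s * y ∈ T) : y ∈ T := by
  let U : Subsemiring Ω :=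
    { carrier := {y | ∃ s ∈ T, s ≠ 0 ∧ s * y ∈ T}
      mul_mem' := by
        rintro y z ⟨s, hs, hs0, hy⟩ ⟨u, hu, hu0, hz⟩
        exact ⟨s * u, mul_mem hs hu, mul_ne_zero hs0 hu0, by
          rw [mul_mul_mul_comm]; exact mul_mem hy hz⟩
      one_mem' := ⟨1, one_mem T, one_ne_zero, by simp⟩
      add_mem' := by
        rintro y z ⟨s, hs, hs0, hy⟩ ⟨u, hu, hu0, hz⟩
        refine ⟨s * u, mul_mem hs hu, mul_ne_zero hs0 hu0, ?_⟩
        have : s * u * (y + z) = u * (s * y) + s * (u * z) := by ring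
        rw [this]
        exact add_mem (mul_mem hu hy) (mul_mem hs hz)
      zero_mem' := ⟨1, one_mem T, one_ne_zero, by simp⟩ }
  refine hT.le_of_ge (y := U) ⟨?_, ?_⟩ (fun x hx => ⟨1, one_mem T, one_ne_zero, by simpa using hx⟩)
    ⟨s, hs, hs0, hy⟩
  · rintro x ⟨s, hs, hs0, hx⟩ ⟨u, hu, hu0, hnx⟩
    have h := hT.prop.eq_zero (u * (s * x)) (mul_mem hu hx) (by
      rw [show -(u * (s * x)) = s * (u * -x) by ring]; exact mul_mem hs hnx)
    simpa [hs0, hu0] using h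
  · rintro x ⟨s, hs, hs0, hx⟩ y ⟨u, hu, hu0, hy⟩
    have hsu := mul_mem hs hu
    have hsu0 := mul_ne_zero hs0 hu0
    refine (hT.prop.sub_mem_or _ (mul_mem hu hx) _ (mul_mem hs hy)).imp (fun h => ?_) (fun h => ?_)
    · exact ⟨s * u, hsu, hsu0, by
        rwa [show s * u * (x - y) = u * (s * x) - s * (u * y) by ring]⟩
    · exact ⟨s * u, hsu, hsu0, by
        rwa [show s * u * (y - x) = s * (u * y) - u * (s * x) by ring]⟩

/-- The subfield generated by a maximal cone. -/
def Subsemiring.IsOrderCone.subfield (hT : Maximal Subsemiring.IsOrderCone T) : Subfield Ω where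
  carrier := {x | x ∈ T ∨ -x ∈ T}
  mul_mem' := by
    rintro x y (hx | hx) (hy | hy)
    · exact Or.inl (mul_mem hx hy)
    · exact Or.inr (by rw [← mul_neg]; exact mul_mem hx hy)
    · exact Or.inr (by rw [← neg_mul]; exact mul_mem hx hy)
    · exact Or.inl (by rw [← neg_mul_neg]; exact mul_mem hx hy)
  one_mem' := Or.inl (one_mem T)
  add_mem' := by
    rintro x y (hx | hx) (hy | hy)
    · exact Or.inl (add_mem hx hy)
    · have := hT.prop.sub_mem_or x hx _ hy
      rwa [sub_neg_eq_add, ← neg_add', add_comm y x] at this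
    · have := hT.prop.sub_mem_or y hy _ hx
      rwa [sub_neg_eq_add, ← neg_add', add_comm y x] at this
    · exact Or.inr (by rw [neg_add]; exact add_mem hx hy)
  zero_mem' := Or.inl (zero_mem T)
  neg_mem' := by
    rintro x (hx | hx)
    · exact Or.inr (by rwa [neg_neg])
    · exact Or.inl hx
  inv_mem' := by
    have h : ∀ x ∈ T, x⁻¹ ∈ T := by
      intro x hx
      rcases eq_or_ne x 0 with rfl | hx0
      · simp
      · exact mem_of_mul_mem hT hx hx0 (by rw [mul_inv_cancel₀ hx0]; exact one_mem T)
    rintro x (hx | hx)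
    · exact Or.inl (h x hx)
    · exact Or.inr (by rw [← inv_neg]; exact h _ hx)

theorem Subsemiring.IsOrderCone.exists_hasPolynomialIVP [IsAlgClosed Ω]
    (hT : Maximal Subsemiring.IsOrderCone T) :
    ∃ (_ : LinearOrder (subfield hT)) (_ : IsStrictOrderedRing (subfield hT)),
      HasPolynomialIVP (subfield hT) ∧ ∀ x : subfield hT, 0 ≤ x ↔ (x : Ω) ∈ T := by
  classical
  let C : RingCone (subfield hT) :=
    { T.comap (subfield hT).subtype with
      eq_zero_of_mem_of_neg_mem' := fun {x} hx hnx => Subtype.ext (hT.prop.eq_zero x hx hnx) }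
  have : HasMemOrNegMem C := ⟨fun x => x.2⟩
  let _ : LinearOrder (subfield hT) := LinearOrder.mkOfAddGroupCone C
  have : IsOrderedRing (subfield hT) := IsOrderedRing.mkOfCone C
  have : IsStrictOrderedRing (subfield hT) := IsOrderedRing.toIsStrictOrderedRing _
  have hnonneg : ∀ x : subfield hT, 0 ≤ x ↔ (x : Ω) ∈ T := by
    intro x
    change x - 0 ∈ C ↔ _
    rw [sub_zero]
    rfl
  refine ⟨_, this, hasPolynomialIVP_of_maximal (subfield hT).subtype ?_, hnonneg⟩
  intro U hU hle y hy
  have hTU : T ≤ U := fun x hx => hle ⟨x, Or.inl hx⟩ ((hnonneg _).2 hx)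
  exact ⟨⟨y, Or.inl (hT.le_of_ge hU hTU hy)⟩, rfl⟩

theorem RingPreordering.exists_hasPolynomialIVP.{u} {R : Type u} [CommRing R] (P : RingPreordering R)
    [P.IsOrdering] :
    ∃ (L : Type u) (_ : Field L) (_ : LinearOrder L) (_ : IsStrictOrderedRing L) (φ : R →+* L),
      HasPolynomialIVP L ∧ (∀ x ∈ P, 0 ≤ φ x) ∧ ∀ x, φ x = 0 ↔ x ∈ P.support := by
  let K := FractionRing (R ⧸ P.support)
  let φ : R →+* AlgebraicClosure K := (algebraMap K (AlgebraicClosure K)).comp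
    ((algebraMap (R ⧸ P.support) K).comp (Ideal.Quotient.mk P.support))
  have hφ : ∀ x, φ x = 0 ↔ x ∈ P.support := by
    intro x
    simp only [φ, RingHom.comp_apply, map_eq_zero]
    rw [IsFractionRing.to_map_eq_zero_iff, Ideal.Quotient.eq_zero_iff_mem]
  obtain ⟨T, hle, hT⟩ := (P.isOrderCone_map φ hφ).exists_maximal
  obtain ⟨_, _, hIVP, hnonneg⟩ := Subsemiring.IsOrderCone.exists_hasPolynomialIVP hT
  let ψ : R →+* Subsemiring.IsOrderCone.subfield hT := φ.codRestrict _ fun x => by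
    rcases mem_or_neg_mem P x with h | h
    · exact Or.inl (hle ⟨x, h, rfl⟩)
    · exact Or.inr (hle ⟨-x, h, map_neg φ x⟩)
  refine ⟨Subsemiring.IsOrderCone.subfield hT, inferInstance, _, ‹_›, ψ, hIVP,
    fun x hx => (hnonneg _).2 (hle ⟨x, hx, rfl⟩), fun x => ?_⟩
  rw [← hφ x]
  exact Subtype.ext_iff

end RealClosedExtension

section Certificates

theorem IsSOS.zero {σ : Type*} : IsSOS (0 : MvPolynomial σ ℝ) := ⟨0, Fin.elim0, by simp⟩

theorem IsSOS.sq {σ : Type*} (q : MvPolynomial σ ℝ) : IsSOS (q ^ 2) := ⟨1, fun _ => q, by simp⟩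

theorem IsSOS.add {σ : Type*} {s t : MvPolynomial σ ℝ} (hs : IsSOS s) (ht : IsSOS t) :
    IsSOS (s + t) := by
  obtain ⟨k, p, rfl⟩ := hs
  obtain ⟨l, q, rfl⟩ := ht
  exact ⟨k + l, Fin.append p q, by simp [Fin.sum_univ_add]⟩

theorem IsSOS.eval_nonneg {σ : Type*} {s : MvPolynomial σ ℝ} (hs : IsSOS s) (a : σ → ℝ) :
    0 ≤ eval a s := by
  obtain ⟨k, p, rfl⟩ := hs
  simpa using Finset.sum_nonneg fun i _ => sq_nonneg (eval a (p i))

/-- The monoid of products of a square and some of the elements of a family `f`. -/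
def Submonoid.squareMulProd {R ι : Type*} [CommRing R] [DecidableEq ι] (f : ι → R) :
    Submonoid R where
  carrier := {x | ∃ (q : R) (S : Finset ι), x = q ^ 2 * ∏ i ∈ S, f i}
  mul_mem' := by
    rintro _ _ ⟨q, S, rfl⟩ ⟨r, T, rfl⟩
    refine ⟨q * r * ∏ i ∈ S ∩ T, f i, symmDiff S T, ?_⟩
    have h₁ : (∏ i ∈ S ∪ T, f i) * ∏ i ∈ S ∩ T, f i = (∏ i ∈ S, f i) * ∏ i ∈ T, f i :=
      Finset.prod_union_inter
    have h₂ : ∏ i ∈ S ∪ T, f i = (∏ i ∈ symmDiff S T, f i) * ∏ i ∈ S ∩ T, f i := by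
      rw [← Finset.prod_union (by exact disjoint_symmDiff_inf S T)]
      exact congrArg (fun U => ∏ i ∈ U, f i) (symmDiff_sup_inf S T).symm
    linear_combination (q ^ 2 * r ^ 2) * (h₂ * (∏ i ∈ S ∩ T, f i) - h₁)
  one_mem' := ⟨1, ∅, by simp⟩

theorem exists_isSOS_of_mem_closure_squareMulProd {σ ι : Type*} [Fintype ι] [DecidableEq ι]
    {f : ι → MvPolynomial σ ℝ} {c : MvPolynomial σ ℝ}
    (hc : c ∈ (Submonoid.squareMulProd f).subsemiringClosure) :
    ∃ s : Finset ι → MvPolynomial σ ℝ, (∀ S, IsSOS (s S)) ∧ c = ∑ S, s S * ∏ i ∈ S, f i := by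
  rw [Submonoid.subsemiringClosure_mem] at hc
  induction hc using AddSubmonoid.closure_induction with
  | mem c hc =>
    obtain ⟨q, S, rfl⟩ := hc
    refine ⟨Pi.single S (q ^ 2), fun T => ?_, ?_⟩
    · rcases eq_or_ne T S with rfl | hT
      · simpa using IsSOS.sq q
      · simpa [hT] using IsSOS.zero
    · rw [Finset.sum_eq_single S (fun T _ hT => by simp [hT]) (by simp), Pi.single_eq_same]
  | zero => exact ⟨0, fun _ => IsSOS.zero, by simp⟩
  | add c d _ _ hc hd =>
    obtain ⟨s, hs, rfl⟩ := hc
    obtain ⟨t, ht, rfl⟩ := hd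
    exact ⟨s + t, fun S => (hs S).add (ht S), by simp [add_mul, Finset.sum_add_distrib]⟩

/-- The subsemiring generated by the squares, the family `f` and the ideal `I`. -/
def Ideal.conePlus {R ι : Type*} [CommRing R] [DecidableEq ι] (I : Ideal R) (f : ι → R) :
    Subsemiring R :=
  ((Submonoid.squareMulProd f).subsemiringClosure.map (Ideal.Quotient.mk I)).comap
    (Ideal.Quotient.mk I)

theorem Ideal.mem_conePlus {R ι : Type*} [CommRing R] [DecidableEq ι] {I : Ideal R} {f : ι → R}
    {x : R} :
    x ∈ I.conePlus f ↔ ∃ c ∈ (Submonoid.squareMulProd f).subsemiringClosure, c - x ∈ I := by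
  simp only [Ideal.conePlus, Subsemiring.mem_comap, Subsemiring.mem_map, Ideal.Quotient.eq]

theorem Ideal.sq_mul_prod_mem_conePlus {R ι : Type*} [CommRing R] [DecidableEq ι] (I : Ideal R)
    (f : ι → R) (q : R) (S : Finset ι) : q ^ 2 * ∏ i ∈ S, f i ∈ I.conePlus f :=
  Ideal.mem_conePlus.2 ⟨_, (Submonoid.subsemiringClosure_mem _).2
    (AddSubmonoid.subset_closure ⟨q, S, rfl⟩), by simp⟩

theorem exists_point_of_forall_neg_sq_notMem_conePlus {N : ℕ} {ι : Type*} [Fintype ι]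
    [DecidableEq ι] (f : ι → MvPolynomial (Fin N) ℝ) {G H : Finset (MvPolynomial (Fin N) ℝ)}
    (hneg : ∀ m ∈ Submonoid.closure (G : Set (MvPolynomial (Fin N) ℝ)),
      -(m * m) ∉ (Ideal.span (H : Set (MvPolynomial (Fin N) ℝ))).conePlus f) :
    ∃ a : Fin N → ℝ, (∀ i, 0 ≤ eval a (f i)) ∧ (∀ g ∈ G, eval a g ≠ 0) ∧
      ∀ h ∈ H, eval a h = 0 := by
  classical
  set I := Ideal.span (H : Set (MvPolynomial (Fin N) ℝ))
  obtain ⟨P, hle, hP, hord⟩ := (I.conePlus f).exists_isOrdering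
    (fun x => by simpa [sq] using I.sq_mul_prod_mem_conePlus f x ∅) _ hneg
  obtain ⟨L, _, _, _, φ, hL, hφ, hφ₀⟩ := P.exists_hasPolynomialIVP
  obtain ⟨a, ha⟩ := exists_real_point_sign_eq hL N φ (Finset.univ.image f ∪ G ∪ H)
  refine ⟨a, fun i => ?_, fun g hg h₀ => ?_, fun h hh => ?_⟩
  · rw [← sign_nonneg_iff, ← ha (f i) (by simp), sign_nonneg_iff]
    exact hφ _ (hle (by simpa using I.sq_mul_prod_mem_conePlus f 1 {i}))
  · rw [← sign_eq_zero_iff, ← ha g (by simp [hg]), sign_eq_zero_iff, hφ₀] at h₀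
    refine hP g (Submonoid.subset_closure hg) ?_
    exact (RingPreordering.mem_support.1 (Ideal.mul_mem_left _ g h₀)).2
  · rw [← sign_eq_zero_iff, ← ha h (by simp [hh]), sign_eq_zero_iff, hφ₀]
    have hI : h ∈ I := Ideal.subset_span hh
    exact RingPreordering.mem_support.2
      ⟨hle (Ideal.mem_conePlus.2 ⟨0, zero_mem _, by simpa using hI⟩),
        hle (Ideal.mem_conePlus.2 ⟨0, zero_mem _, by simpa using hI⟩)⟩

end Certificates

/-- **Krivine–Stengle Positivstellensatz.** Let `(f i)`, `(g j)`, `(h k)` be finite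
families of polynomials in `ℝ[y₁,…,y_N]`. The semialgebraic set
`{a : f i (a) ≥ 0 ∀i, g j (a) ≠ 0 ∀j, h k (a) = 0 ∀k}` is empty if and only if there exist
`F ∈ Cone({f i})` (i.e. `F = Σ_{S} σ_S · Π_{i ∈ S} f i` with each `σ_S` a sum of squares),
`G ∈ Monoid({g j})` (i.e. `G = Π_j (g j)^(k j)`), and `H ∈ Ideal({h k})`
(i.e. `H = Σ_k t k · h k`) such that `F + G² + H = 0`. -/
theorem krivine_stengle_positivstellensatz
    (N nI nJ nK : ℕ)
    (f : Fin nI → MvPolynomial (Fin N) ℝ)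
    (g : Fin nJ → MvPolynomial (Fin N) ℝ)
    (h : Fin nK → MvPolynomial (Fin N) ℝ) :
    {a : Fin N → ℝ | (∀ i, 0 ≤ eval a (f i)) ∧ (∀ j, eval a (g j) ≠ 0) ∧
        (∀ k, eval a (h k) = 0)} = ∅ ↔
      ∃ (σ : Finset (Fin nI) → MvPolynomial (Fin N) ℝ) (kpow : Fin nJ → ℕ)
        (t : Fin nK → MvPolynomial (Fin N) ℝ),
        (∀ S, IsSOS (σ S)) ∧
        (∑ S : Finset (Fin nI), σ S * ∏ i ∈ S, f i) +
          (∏ j, g j ^ kpow j) ^ 2 + (∑ k, t k * h k) = 0 := by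
  classical
  constructor
  · intro hempty
    by_contra hcert
    have hneg : ∀ m ∈ Submonoid.closure (Set.range g),
        -(m * m) ∉ (Ideal.span (Set.range h)).conePlus f := by
      intro m hm hmem
      obtain ⟨c, hc, hcm⟩ := Ideal.mem_conePlus.1 hmem
      obtain ⟨σ, hσ, rfl⟩ := exists_isSOS_of_mem_closure_squareMulProd hc
      obtain ⟨e, rfl⟩ := Submonoid.mem_closure_range_iff_of_fintype.1 hm
      obtain ⟨t, ht⟩ := Ideal.mem_span_range_iff_exists_fun.1 hcm
      refine hcert ⟨σ, e, -t, hσ, ?_⟩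
      simp only [Pi.neg_apply, neg_mul, Finset.sum_neg_distrib, ht]
      ring
    obtain ⟨a, hf, hg, hh⟩ := exists_point_of_forall_neg_sq_notMem_conePlus f
      (G := Finset.univ.image g) (H := Finset.univ.image h) (by simpa using hneg)
    have : a ∈ (∅ : Set (Fin N → ℝ)) := hempty ▸
      ⟨hf, fun j => hg _ (by simp), fun k => hh _ (by simp)⟩
    exact this
  · rintro ⟨σ, e, t, hσ, hsum⟩
    refine Set.eq_empty_of_forall_notMem fun a ⟨hf, hg, hh⟩ => ?_
    have h₁ : 0 ≤ eval a (∑ S : Finset (Fin nI), σ S * ∏ i ∈ S, f i) := by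
      rw [map_sum]
      refine Finset.sum_nonneg fun S _ => ?_
      rw [map_mul, map_prod]
      exact mul_nonneg ((hσ S).eval_nonneg a) (Finset.prod_nonneg fun i _ => hf i)
    have h₂ : 0 < eval a ((∏ j, g j ^ e j) ^ 2) := by
      rw [map_pow, map_prod]
      refine sq_pos_of_ne_zero (Finset.prod_ne_zero_iff.2 fun j _ => ?_)
      rw [map_pow]
      exact pow_ne_zero _ (hg j)
    have h₃ : eval a (∑ k, t k * h k) = 0 := by simp [hh]
    have := congrArg (eval a) hsum
    rw [map_add, map_add, h₃, map_zero] at this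
    linarith
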